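/- arXiv:2402.15329 — 5 statements merged into one kernel-verified Lean document; each statement's English description precedes it below -/
import Mathlib

section
/- Let λ₁, λ₂, λ₃ be pairwise distinct complex numbers and let f(x) = (x−λ₁)(x−λ₂)(x−λ₃). If a, b ∈ ℂ[t] are polynomials satisfying b² = f(a) = (a−λ₁)(a−λ₂)(a−λ₃) in ℂ[t], then both a and b are constant polynomials. (Equivalently: the smooth affine cubic curve E : y² = f(x) admits no nonconstant morphism from the affine line 𝔸¹_ℂ; this is the 𝔸¹-rigidity of E used throughout the paper.) -/
open Polynomial

lemma isCoprime_sub_C_sub_C {x y : ℂ} (hxy : x ≠ y) (a : ℂ[X]) :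
    IsCoprime (a - C x) (a - C y) := by
  simpa using (isCoprime_X_sub_C_of_isUnit_sub (sub_ne_zero.2 hxy).isUnit).map (compRingHom a)

lemma exists_eq_sq_of_isCoprime_of_mul_eq_sq {p q b : ℂ[X]} (hpq : IsCoprime p q)
    (h : p * q = b ^ 2) : ∃ s, p = s ^ 2 := by
  obtain ⟨d, u, hu⟩ := exists_associated_pow_of_mul_eq_pow' hpq h
  obtain ⟨c, -, hc⟩ := Polynomial.isUnit_iff.1 u.isUnit
  obtain ⟨r, hr⟩ := IsAlgClosed.exists_pow_nat_eq c two_pos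
  exact ⟨d * C r, by rw [← hu, ← hc, ← hr, C_pow, mul_pow]⟩

lemma natDegree_eq_zero_of_isUnit_sq_sub_sq {s t : ℂ[X]} (h : IsUnit (s ^ 2 - t ^ 2)) :
    s.natDegree = 0 := by
  rw [sq_sub_sq] at h
  obtain ⟨h₁, h₂⟩ := IsUnit.mul_iff.1 h
  have key : C 2 * s = (s + t) + (s - t) := by rw [C_ofNat]; ring
  have hle := natDegree_add_le (s + t) (s - t)
  rw [← key, natDegree_C_mul two_ne_zero, natDegree_eq_zero_of_isUnit h₁,
    natDegree_eq_zero_of_isUnit h₂] at hle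
  simpa using hle

/-- Let `λ₁, λ₂, λ₃` be pairwise distinct complex numbers and
`f(x) = (x−λ₁)(x−λ₂)(x−λ₃)`.  If `a, b ∈ ℂ[t]` satisfy `b² = f(a)`, then both
`a` and `b` are constant polynomials (𝔸¹-rigidity of the affine curve `E : y² = f(x)`). -/
theorem constant_of_sq_eq_cubic
    (l1 l2 l3 : ℂ) (h12 : l1 ≠ l2) (h13 : l1 ≠ l3) (h23 : l2 ≠ l3)
    (a b : Polynomial ℂ)
    (h : b ^ 2 = (a - C l1) * (a - C l2) * (a - C l3)) :
    (∃ ca : ℂ, a = C ca) ∧ (∃ cb : ℂ, b = C cb) := by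
  obtain ⟨s, hs⟩ := exists_eq_sq_of_isCoprime_of_mul_eq_sq
    ((isCoprime_sub_C_sub_C h12 a).mul_right (isCoprime_sub_C_sub_C h13 a))
    (by rw [h, mul_assoc])
  obtain ⟨t, ht⟩ := exists_eq_sq_of_isCoprime_of_mul_eq_sq
    ((isCoprime_sub_C_sub_C h12.symm a).mul_right (isCoprime_sub_C_sub_C h23 a))
    (show (a - C l2) * ((a - C l1) * (a - C l3)) = b ^ 2 by rw [h]; ring)
  have hu : IsUnit (s ^ 2 - t ^ 2) := by
    rw [← hs, ← ht, sub_sub_sub_cancel_left, ← C_sub]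
    exact isUnit_C.2 (sub_ne_zero.2 h12.symm).isUnit
  have hsC := eq_C_of_natDegree_eq_zero (natDegree_eq_zero_of_isUnit_sq_sub_sq hu)
  obtain ⟨c, rfl⟩ : ∃ c, a = C c := by
    refine ⟨s.coeff 0 ^ 2 + l1, ?_⟩
    rw [C_add, C_pow, ← hsC, ← hs, sub_add_cancel]
  refine ⟨⟨c, rfl⟩, b.coeff 0, eq_C_of_natDegree_eq_zero ?_⟩
  have hb := congrArg natDegree h
  rw [natDegree_pow, ← C_sub, ← C_sub, ← C_sub, ← C_mul, ← C_mul, natDegree_C] at hb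
  lia
end

section
/- Let λ₁, λ₂, λ₃ be pairwise distinct complex numbers and let f(x) = (x−λ₁)(x−λ₂)(x−λ₃). If a, b are elements of the field ℂ(t) of rational functions in one variable satisfying b² = f(a) = (a−λ₁)(a−λ₂)(a−λ₃) in ℂ(t), then a and b are constant, i.e., they lie in ℂ. (This encodes that every rational map from 𝔸¹_ℂ to the elliptic curve E : y² = f(x) extends to a morphism to the projective closure Ē and is constant, since Ē is 𝔸¹-rigid.) -/
open Polynomial in
/-- If `A` is a square up to a unit, its square root divides every Wronskian involving `A`. -/
lemma Polynomial.dvd_wronskian_of_associated_sq {K : Type*} [Field K] {s A B : K[X]}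
    (h : Associated (s ^ 2) A) : s ∣ wronskian A B := by
  obtain ⟨u, rfl⟩ := h
  refine ⟨s * u * derivative B - (2 * derivative s * u + s * derivative (u : K[X])) * B, ?_⟩
  simp only [wronskian, derivative_mul, derivative_pow]
  push_cast
  simp only [map_ofNat, pow_one]
  ring

open Polynomial in
lemma Polynomial.wronskian_sub_C_mul_sub_C_mul {K : Type*} [Field K] (l m : K) (p q : K[X]) :
    wronskian (p - C l * q) (p - C m * q) = C (l - m) * wronskian p q := by
  simp only [wronskian, derivative_sub, derivative_mul, derivative_C, C_sub]
  ring

open Polynomial in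
lemma Polynomial.wronskian_sub_C_mul_self {K : Type*} [Field K] (l : K) (p q : K[X]) :
    wronskian (p - C l * q) q = wronskian p q := by
  simp only [wronskian, derivative_sub, derivative_mul, derivative_C]
  ring

open Polynomial in
lemma IsCoprime.sub_C_mul_left {K : Type*} [Field K] {p q : K[X]} (h : IsCoprime p q) (l : K) :
    IsCoprime (p - C l * q) q := by
  simpa [sub_eq_add_neg] using h.add_mul_right_left (-C l)

open Polynomial in
lemma IsCoprime.sub_C_mul_sub_C_mul {K : Type*} [Field K] {p q : K[X]} (h : IsCoprime p q)
    {l m : K} (hlm : l ≠ m) : IsCoprime (p - C l * q) (p - C m * q) := by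
  have hu : IsUnit (C (l - m)) := isUnit_C.mpr (sub_ne_zero.mpr hlm).isUnit
  have h1 := (isCoprime_mul_unit_left_right hu _ _).mpr (h.sub_C_mul_left l)
  have h2 : p - C m * q = C (l - m) * q + (p - C l * q) * 1 := by
    rw [C_sub]
    ring
  exact h2 ▸ h1.add_mul_left_right 1

open Polynomial in
/-- If `p`, `q` are coprime and `q (p - l₁ q) (p - l₂ q) (p - l₃ q)` is a square, then the
Wronskian of `p` and `q` vanishes. -/
lemma Polynomial.wronskian_eq_zero_of_mul_eq_sq {K : Type*} [Field K] {l1 l2 l3 : K}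
    (h12 : l1 ≠ l2) (h13 : l1 ≠ l3) (h23 : l2 ≠ l3) {p q r : K[X]} (hpq : IsCoprime p q)
    (h : q * ((p - C l1 * q) * ((p - C l2 * q) * (p - C l3 * q))) = r ^ 2) :
    wronskian p q = 0 := by
  by_contra hw
  have w1 := wronskian_sub_C_mul_self l1 p q
  have w2 := wronskian_sub_C_mul_self l2 p q
  have w3 := wronskian_sub_C_mul_self l3 p q
  have w23 := wronskian_sub_C_mul_sub_C_mul l2 l3 p q
  have c1 := hpq.sub_C_mul_left l1
  have c2 := hpq.sub_C_mul_left l2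
  have c3 := hpq.sub_C_mul_left l3
  have c12 := hpq.sub_C_mul_sub_C_mul h12
  have c13 := hpq.sub_C_mul_sub_C_mul h13
  have c23 := hpq.sub_C_mul_sub_C_mul h23
  have wq : wronskian q (p - C l1 * q) = -wronskian p q := by
    rw [← w1, wronskian_neg_eq]
  generalize p - C l1 * q = A at *
  generalize p - C l2 * q = B at *
  generalize p - C l3 * q = D at *
  obtain ⟨s0, h0⟩ := exists_associated_pow_of_mul_eq_pow'
    (c1.symm.mul_right (c2.symm.mul_right c3.symm)) h
  obtain ⟨s1, h1⟩ := exists_associated_pow_of_mul_eq_pow'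
    (c1.mul_right (c12.mul_right c13)) (b := q * (B * D)) (c := r) (k := 2)
    (by rw [← h]; ring)
  obtain ⟨s2, h2⟩ := exists_associated_pow_of_mul_eq_pow'
    (c2.mul_right (c12.symm.mul_right c23)) (b := q * (A * D)) (c := r) (k := 2)
    (by rw [← h]; ring)
  obtain ⟨s3, h3⟩ := exists_associated_pow_of_mul_eq_pow'
    (c3.mul_right (c13.symm.mul_right c23.symm)) (b := q * (A * B)) (c := r) (k := 2)
    (by rw [← h]; ring)
  have d1 : s1 ∣ wronskian p q := w1 ▸ dvd_wronskian_of_associated_sq h1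
  have d2 : s2 ∣ wronskian p q := w2 ▸ dvd_wronskian_of_associated_sq h2
  have d3 : s3 ∣ wronskian p q := w3 ▸ dvd_wronskian_of_associated_sq h3
  have d0 : s0 ∣ wronskian p q := by
    rw [← dvd_neg, ← wq]
    exact dvd_wronskian_of_associated_sq h0
  have root {s t X Y : K[X]} (hs : Associated (s ^ 2) X) (ht : Associated (t ^ 2) Y)
      (hc : IsCoprime X Y) : IsCoprime s t :=
    (hc.of_isCoprime_of_dvd_left
      ((dvd_pow_self s two_ne_zero).trans hs.dvd)).of_isCoprime_of_dvd_right
      ((dvd_pow_self t two_ne_zero).trans ht.dvd)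
  have hdvd : s0 * (s1 * (s2 * s3)) ∣ wronskian p q :=
    ((root h0 h1 c1.symm).mul_right
      ((root h0 h2 c2.symm).mul_right (root h0 h3 c3.symm))).mul_dvd d0
      (((root h1 h2 c12).mul_right (root h1 h3 c13)).mul_dvd d1
        ((root h2 h3 c23).mul_dvd d2 d3))
  have hne := ne_zero_of_dvd_ne_zero hw hdvd
  have hle := natDegree_le_of_dvd hdvd hw
  simp only [mul_ne_zero_iff] at hne
  obtain ⟨n0, n1, n2, n3⟩ := hne
  rw [natDegree_mul n0 (by simp [*]), natDegree_mul n1 (by simp [*]), natDegree_mul n2 n3] at hle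
  have hlm : l2 - l3 ≠ 0 := sub_ne_zero.mpr h23
  have lt1 := natDegree_wronskian_lt_add (w1 ▸ hw)
  have lt2 := natDegree_wronskian_lt_add (a := B) (b := D)
    (w23 ▸ mul_ne_zero (C_ne_zero.mpr hlm) hw)
  rw [w1] at lt1
  rw [w23, natDegree_C_mul hlm] at lt2
  have e0 := natDegree_eq_of_degree_eq (degree_eq_degree_of_associated h0)
  have e1 := natDegree_eq_of_degree_eq (degree_eq_degree_of_associated h1)
  have e2 := natDegree_eq_of_degree_eq (degree_eq_degree_of_associated h2)
  have e3 := natDegree_eq_of_degree_eq (degree_eq_degree_of_associated h3)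
  rw [natDegree_pow] at e0 e1 e2 e3
  omega

theorem constant_of_sq_eq_cubic_ratFunc
    (l1 l2 l3 : ℂ) (h12 : l1 ≠ l2) (h13 : l1 ≠ l3) (h23 : l2 ≠ l3)
    (a b : RatFunc ℂ)
    (h : b ^ 2 = (a - RatFunc.C l1) * (a - RatFunc.C l2) * (a - RatFunc.C l3)) :
    (∃ ca : ℂ, a = RatFunc.C ca) ∧ (∃ cb : ℂ, b = RatFunc.C cb) := by
  have ha : ∃ ca : ℂ, a = RatFunc.C ca := by
    have hq : algebraMap (Polynomial ℂ) (RatFunc ℂ) a.denom ≠ 0 :=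
      RatFunc.algebraMap_ne_zero a.denom_ne_zero
    have key : (b * algebraMap (Polynomial ℂ) (RatFunc ℂ) a.denom ^ 2) ^ 2 =
        algebraMap (Polynomial ℂ) (RatFunc ℂ) (a.denom * ((a.num - Polynomial.C l1 * a.denom) *
          ((a.num - Polynomial.C l2 * a.denom) * (a.num - Polynomial.C l3 * a.denom)))) := by
      have hn : algebraMap (Polynomial ℂ) (RatFunc ℂ) a.num =
          a * algebraMap (Polynomial ℂ) (RatFunc ℂ) a.denom := by
        rw [← div_eq_iff hq, RatFunc.num_div_denom]
      simp only [map_mul, map_sub, hn, RatFunc.algebraMap_C, mul_pow, h]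
      ring
    obtain ⟨r, hr⟩ := IsIntegrallyClosed.exists_algebraMap_eq_of_isIntegral_pow
      (R := Polynomial ℂ) (n := 2) two_pos (key ▸ isIntegral_algebraMap)
    rw [← hr, ← map_pow] at key
    have hw := Polynomial.wronskian_eq_zero_of_mul_eq_sq h12 h13 h23 a.isCoprime_num_denom
      (RatFunc.algebraMap_injective ℂ key).symm
    obtain ⟨hp', hq'⟩ := a.isCoprime_num_denom.wronskian_eq_zero_iff.mp hw
    obtain ⟨x, hx⟩ := Polynomial.natDegree_eq_zero.mp
      (Polynomial.derivative_eq_zero.mp hp')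
    obtain ⟨y, hy⟩ := Polynomial.natDegree_eq_zero.mp
      (Polynomial.derivative_eq_zero.mp hq')
    refine ⟨x / y, ?_⟩
    rw [map_div₀, ← RatFunc.algebraMap_C, ← RatFunc.algebraMap_C, hx, hy, RatFunc.num_div_denom]
  refine ⟨ha, ?_⟩
  obtain ⟨x, rfl⟩ := ha
  obtain ⟨d, hd⟩ := IsAlgClosed.exists_pow_nat_eq ((x - l1) * (x - l2) * (x - l3)) two_pos
  have hb : b ^ 2 = RatFunc.C d ^ 2 := by
    rw [h, ← map_pow, hd]
    simp only [map_mul, map_sub]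
  rcases sq_eq_sq_iff_eq_or_eq_neg.mp hb with hb | hb
  · exact ⟨d, hb⟩
  · exact ⟨-d, by rw [hb, map_neg]⟩
end

section
/- Let c ∈ ℂ be a fixed complex number and let λ₁, λ₂, λ₃ be pairwise distinct nonzero complex numbers with f(x) = (x−λ₁)(x−λ₂)(x−λ₃). Suppose a, b ∈ ℂ[t] satisfy b² = c²·f(a) in ℂ[t] and for every t ∈ ℂ the triple (c, a(t), b(t)) is not (0,0,0). Then a and b are constant polynomials. (This is the 𝔸¹-rigidity, with respect to maps from the affine line, of the fibers of φₙ : Xₙ → Xₙ₋₁ over closed points: each such fiber is isomorphic either to the curve E : y² = f(x) when c ≠ 0, or to Spec ℂ[x,y]/⟨y²⟩ minus the origin when c = 0, and neither admits a nonconstant morphism from 𝔸¹_ℂ.) -/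
open Polynomial

/-- Over `ℂ`, a polynomial dividing a square with coprime cofactor is itself a square. -/
theorem isSquare_of_isCoprime_of_mul_eq_sq {p q r : ℂ[X]} (hpq : IsCoprime p q)
    (h : p * q = r ^ 2) : ∃ s : ℂ[X], p = s ^ 2 := by
  obtain ⟨d, u, hu⟩ := exists_associated_pow_of_mul_eq_pow' hpq h
  obtain ⟨k, -, hk⟩ := Polynomial.isUnit_iff.mp u.isUnit
  obtain ⟨z, hz⟩ := IsAlgClosed.exists_pow_nat_eq k (n := 2) (by norm_num)
  refine ⟨C z * d, ?_⟩
  rw [← hu, ← hk, ← hz, C_pow]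
  ring

theorem isCoprime_sub_C_sub_C_s7 (a : ℂ[X]) {l m : ℂ} (h : l ≠ m) :
    IsCoprime (a - C l) (a - C m) := by
  have hml : m - l ≠ 0 := sub_ne_zero.mpr h.symm
  refine ⟨C (m - l)⁻¹, -C (m - l)⁻¹, ?_⟩
  have : C (m - l)⁻¹ * (a - C l) + -C (m - l)⁻¹ * (a - C m) = C (m - l)⁻¹ * C (m - l) := by
    rw [C_sub]; ring
  rw [this, ← C_mul, inv_mul_cancel₀ hml, C_1]

/-- Two polynomials over `ℂ` whose squares differ by a nonzero constant are constant. -/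
theorem exists_eq_C_of_sq_sub_sq_eq_C {u v : ℂ[X]} {k : ℂ} (hk : k ≠ 0)
    (h : u ^ 2 - v ^ 2 = C k) : ∃ z : ℂ, u = C z := by
  have hunit : IsUnit ((u + v) * (u - v)) := by
    rw [← sq_sub_sq, h]
    exact isUnit_C.mpr hk.isUnit
  obtain ⟨hadd, hsub⟩ := IsUnit.mul_iff.mp hunit
  obtain ⟨x, -, hx⟩ := Polynomial.isUnit_iff.mp hadd
  obtain ⟨y, -, hy⟩ := Polynomial.isUnit_iff.mp hsub
  refine ⟨2⁻¹ * (x + y), ?_⟩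
  have h2 : (C (2⁻¹ : ℂ)) * 2 = 1 := by
    rw [← C_ofNat, ← C_mul]
    norm_num
  rw [C_mul, C_add, hx, hy]
  linear_combination -u * h2

/-- Fix `c ∈ ℂ` and pairwise distinct nonzero `λ₁, λ₂, λ₃` with
`f(x) = (x−λ₁)(x−λ₂)(x−λ₃)`.  If `a, b ∈ ℂ[t]` satisfy `b² = c²·f(a)` and for every
`t ∈ ℂ` the triple `(c, a(t), b(t))` is not `(0,0,0)`, then `a` and `b` are constant
polynomials (𝔸¹-rigidity of the fibers of `φₙ` over closed points). -/
theorem fiber_rigid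
    (l1 l2 l3 : ℂ) (h1 : l1 ≠ 0) (h2 : l2 ≠ 0) (h3 : l3 ≠ 0)
    (h12 : l1 ≠ l2) (h13 : l1 ≠ l3) (h23 : l2 ≠ l3)
    (c : ℂ) (a b : Polynomial ℂ)
    (heq : b ^ 2 = C c ^ 2 * ((a - C l1) * (a - C l2) * (a - C l3)))
    (hnz : ∀ t : ℂ, ¬ (c = 0 ∧ a.eval t = 0 ∧ b.eval t = 0)) :
    (∃ ka : ℂ, a = C ka) ∧ (∃ kb : ℂ, b = C kb) := by
  have ha : ∃ ka : ℂ, a = C ka := by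
    by_cases hc : c = 0
    · have hb : b = 0 := by simpa [hc] using heq
      have hdeg : a.degree = 0 := by
        by_contra hd
        obtain ⟨t, ht⟩ := IsAlgClosed.exists_root a hd
        exact hnz t ⟨hc, ht, by simp [hb]⟩
      exact ⟨_, eq_C_of_degree_eq_zero hdeg⟩
    · have hprod : (a - C l1) * (a - C l2) * (a - C l3) = (C c⁻¹ * b) ^ 2 := by
        have hcc : C c⁻¹ * C c = 1 := by rw [← C_mul, inv_mul_cancel₀ hc, C_1]
        rw [mul_pow, heq, ← mul_assoc, ← mul_pow, hcc, one_pow, one_mul]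
      obtain ⟨u, hu⟩ := isSquare_of_isCoprime_of_mul_eq_sq
        ((isCoprime_sub_C_sub_C_s7 a h12).mul_right
          (isCoprime_sub_C_sub_C_s7 a h13)) ((mul_assoc _ _ _).symm.trans hprod)
      obtain ⟨v, hv⟩ := isSquare_of_isCoprime_of_mul_eq_sq
        ((isCoprime_sub_C_sub_C_s7 a h12.symm).mul_right
          (isCoprime_sub_C_sub_C_s7 a h23)) (r := C c⁻¹ * b) (by rw [← hprod]; ring)
      obtain ⟨z, hz⟩ := exists_eq_C_of_sq_sub_sq_eq_C (u := u) (v := v)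
        (sub_ne_zero.mpr h12.symm) (by rw [← hu, ← hv, C_sub]; ring)
      refine ⟨z ^ 2 + l1, ?_⟩
      rw [C_add, C_pow, ← hz, ← hu]
      ring
  refine ⟨ha, ?_⟩
  obtain ⟨ka, rfl⟩ := ha
  have hdeg : (b ^ 2).natDegree = 0 := by
    rw [heq]
    simp only [← C_sub, ← C_mul, ← C_pow, natDegree_C]
  rw [natDegree_pow] at hdeg
  exact ⟨_, eq_C_of_natDegree_eq_zero (by lia)⟩
end

section
/- Let λ₁, λ₂, λ₃ be pairwise distinct nonzero complex numbers, f(x) = (x−λ₁)(x−λ₂)(x−λ₃), and fix λ ∈ ℂ with λ² = −λ₁λ₂λ₃ (so λ² = f(0) and λ ≠ 0). Suppose a, b, c ∈ ℂ[t] satisfy c² = a²·f(b) in ℂ[t], the polynomials a, b, c have no common zero in ℂ, and there exists t₀ ∈ ℂ with a(t₀) = 1, b(t₀) = 0, c(t₀) = λ. Then a, b, c are all constant polynomials (equal to 1, 0, λ respectively). In other words, every morphism 𝔸¹_ℂ → X₁ whose image contains the point α₁ = (1, 0, λ) is constant. -/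
open Polynomial

/-- The translates of a polynomial by two distinct constants are coprime. -/
theorem isCoprime_sub_C_of_ne {K : Type*} [Field K] (b : Polynomial K) {r s : K} (h : r ≠ s) :
    IsCoprime (b - C r) (b - C s) := by
  refine ⟨C (s - r)⁻¹, -C (s - r)⁻¹, ?_⟩
  calc C (s - r)⁻¹ * (b - C r) + -C (s - r)⁻¹ * (b - C s)
      = C (s - r)⁻¹ * (C s - C r) := by ring
    _ = 1 := by rw [← C_sub, ← C_mul, inv_mul_cancel₀ (sub_ne_zero.mpr h.symm), C_1]

/-- Over an algebraically closed field, coprime factors of a square are squares. -/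
theorem exists_sq_eq_of_mul_eq_sq {K : Type*} [Field K] [IsAlgClosed K]
    {p q d : Polynomial K} (hc : IsCoprime p q) (h : p * q = d ^ 2) : ∃ u, p = u ^ 2 := by
  obtain ⟨e, w, hw⟩ := exists_associated_pow_of_mul_eq_pow' hc h
  obtain ⟨r, -, hr⟩ := Polynomial.isUnit_iff.mp w.isUnit
  obtain ⟨s, hs⟩ := IsAlgClosed.exists_pow_nat_eq r (n := 2) two_pos
  exact ⟨e * C s, by rw [← hw, ← hr, ← hs, mul_pow, C_pow]⟩

/-- Two polynomials whose squares differ by a nonzero constant are constant. -/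
theorem natDegree_eq_zero_of_sq_sub_sq_eq_C {K : Type*} [Field K] [NeZero (2 : K)]
    {u v : Polynomial K} {r : K} (hr : r ≠ 0) (h : u ^ 2 - v ^ 2 = C r) : u.natDegree = 0 := by
  have hu : IsUnit ((u + v) * (u - v)) := by
    rw [← sq_sub_sq, h]
    exact isUnit_C.mpr hr.isUnit
  obtain ⟨x, -, hx⟩ := Polynomial.isUnit_iff.mp (isUnit_of_mul_isUnit_left hu)
  obtain ⟨y, -, hy⟩ := Polynomial.isUnit_iff.mp (isUnit_of_mul_isUnit_right hu)
  have huxy : C (2 : K) * u = C (x + y) := by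
    rw [C_add, hx, hy, C_ofNat]
    ring
  rw [← natDegree_C_mul (two_ne_zero : (2 : K) ≠ 0), huxy, natDegree_C]

/-- An affine cubic `y² = (x - l₁)(x - l₂)(x - l₃)` with distinct roots admits no nonconstant
polynomial parametrization. -/
theorem natDegree_eq_zero_of_sq_eq_cubic {K : Type*} [Field K] [IsAlgClosed K] [NeZero (2 : K)]
    {l1 l2 l3 : K} (h12 : l1 ≠ l2) (h13 : l1 ≠ l3) (h23 : l2 ≠ l3) {b d : Polynomial K}
    (h : d ^ 2 = (b - C l1) * (b - C l2) * (b - C l3)) : b.natDegree = 0 := by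
  obtain ⟨u, hu⟩ := exists_sq_eq_of_mul_eq_sq (d := d)
    ((isCoprime_sub_C_of_ne b h12).mul_right (isCoprime_sub_C_of_ne b h13)) (by rw [h]; ring)
  obtain ⟨v, hv⟩ := exists_sq_eq_of_mul_eq_sq (d := d)
    ((isCoprime_sub_C_of_ne b h12.symm).mul_right (isCoprime_sub_C_of_ne b h23))
    (by rw [h]; ring)
  have hu0 : u.natDegree = 0 :=
    natDegree_eq_zero_of_sq_sub_sq_eq_C (v := v) (sub_ne_zero.mpr h12.symm)
      (by rw [← hu, ← hv, C_sub]; ring)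
  rw [← natDegree_sub_C (a := l1), hu, natDegree_pow, hu0, mul_zero]

/-- Let `λ₁, λ₂, λ₃` be pairwise distinct nonzero complex numbers,
`f(x) = (x−λ₁)(x−λ₂)(x−λ₃)`, and `λ ∈ ℂ` with `λ² = −λ₁λ₂λ₃`.  If `a, b, c ∈ ℂ[t]`
satisfy `c² = a²·f(b)`, have no common zero in `ℂ`, and there is `t₀ ∈ ℂ` with
`(a(t₀), b(t₀), c(t₀)) = (1, 0, λ)`, then `a = 1`, `b = 0` and `c = λ` as polynomials:
every morphism `𝔸¹ → X₁` through the point `α₁ = (1, 0, λ)` is constant. -/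
theorem morphism_through_alpha1_constant
    (l1 l2 l3 : ℂ) (h1 : l1 ≠ 0) (h2 : l2 ≠ 0) (h3 : l3 ≠ 0)
    (h12 : l1 ≠ l2) (h13 : l1 ≠ l3) (h23 : l2 ≠ l3)
    (lam : ℂ) (hlam : lam ^ 2 = -(l1 * l2 * l3))
    (a b c : Polynomial ℂ)
    (heq : c ^ 2 = a ^ 2 * ((b - C l1) * (b - C l2) * (b - C l3)))
    (hnz : ∀ t : ℂ, ¬ (a.eval t = 0 ∧ b.eval t = 0 ∧ c.eval t = 0))
    (t0 : ℂ) (ht0 : a.eval t0 = 1 ∧ b.eval t0 = 0 ∧ c.eval t0 = lam) :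
    a = C 1 ∧ b = C 0 ∧ c = C lam := by
  obtain ⟨hat, hbt, hct⟩ := ht0
  have ha : a ≠ 0 := by
    rintro rfl
    simp at hat
  obtain ⟨d, rfl⟩ : a ∣ c := (IsIntegrallyClosed.pow_dvd_pow_iff two_ne_zero).mp ⟨_, heq⟩
  have hd : d ^ 2 = (b - C l1) * (b - C l2) * (b - C l3) :=
    mul_left_cancel₀ (pow_ne_zero 2 ha) (by rw [← heq, mul_pow])
  obtain ⟨β, rfl⟩ := natDegree_eq_zero.mp (natDegree_eq_zero_of_sq_eq_cubic h12 h13 h23 hd)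
  obtain rfl : β = 0 := by simpa using hbt
  have hd0 : d.natDegree = 0 := by
    have := congrArg natDegree hd
    rw [← C_sub, ← C_sub, ← C_sub, ← C_mul, ← C_mul, natDegree_C, natDegree_pow] at this
    omega
  obtain ⟨δ, rfl⟩ := natDegree_eq_zero.mp hd0
  have ha0 : a.natDegree = 0 := by
    by_contra hne
    obtain ⟨t, ht⟩ := IsAlgClosed.exists_root a fun h => hne (natDegree_eq_of_degree_eq_some h)
    exact hnz t ⟨ht, eval_C, by rw [eval_mul, ht.eq_zero, zero_mul]⟩
  obtain ⟨α, rfl⟩ := natDegree_eq_zero.mp ha0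
  rw [eval_C] at hat
  subst hat
  obtain rfl : δ = lam := by simpa using hct
  exact ⟨rfl, rfl, by rw [C_1, one_mul]⟩
end

section
/- Let n ≥ 1, let λ₁, λ₂, λ₃ be pairwise distinct nonzero complex numbers with f(x) = (x−λ₁)(x−λ₂)(x−λ₃), and fix λ ∈ ℂ with λ² = −λ₁λ₂λ₃. If two points v, w ∈ Xₙ(ℂ) are 𝔸¹-chain equivalent, then their coordinates satisfy pᵢ(v) = pᵢ(w) for all 1 ≤ i ≤ n and qᵢ(v) = qᵢ(w) for all 2 ≤ i ≤ n. (This is the ℂ-points content of the lemma that the projection ψₙ : Xₙ → Xₙ₋₁ onto the coordinates (x₁, x₂, y₂, …, xₙ, yₙ) factors through the sheaf of naive 𝔸¹-connected components of Xₙ.) -/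
open Polynomial

/-- `f` applied to a complex number. -/
noncomputable def fC (l1 l2 l3 z : ℂ) : ℂ := (z - l1) * (z - l2) * (z - l3)

/-- `f` applied to a polynomial. -/
noncomputable def fP (l1 l2 l3 : ℂ) (p : Polynomial ℂ) : Polynomial ℂ :=
  (p - C l1) * (p - C l2) * (p - C l3)

/-- The set `Xₙ(ℂ)` of tuples `(p₀,…,pₙ,q₁,…,qₙ)` with `qᵢ² = pᵢ₋₁²·f(pᵢ)` and
`(pᵢ₋₁, pᵢ, qᵢ) ≠ (0,0,0)` for all `1 ≤ i ≤ n`.  Here `p j` is `p_j` for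
`j : Fin (n+1)` and `q i` is `q_{i+1}` for `i : Fin n`. -/
def XnSet (l1 l2 l3 : ℂ) (n : ℕ) : Set ((Fin (n + 1) → ℂ) × (Fin n → ℂ)) :=
  {v | ∀ i : Fin n,
    v.2 i ^ 2 = v.1 i.castSucc ^ 2 * fC l1 l2 l3 (v.1 i.succ) ∧
    ¬ (v.1 i.castSucc = 0 ∧ v.1 i.succ = 0 ∧ v.2 i = 0)}

/-- Elementary 𝔸¹-homotopy relation on `Xₙ(ℂ)`: `v ∼ w` if there are polynomials
`a₀,…,aₙ,b₁,…,bₙ ∈ ℂ[t]` with `bᵢ² = aᵢ₋₁²·f(aᵢ)` and `aᵢ₋₁, aᵢ, bᵢ` having no common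
zero in `ℂ` for each `1 ≤ i ≤ n`, evaluating to `v` at `t = 0` and to `w` at `t = 1`. -/
def chainReln (l1 l2 l3 : ℂ) (n : ℕ) (v w : XnSet l1 l2 l3 n) : Prop :=
  ∃ (a : Fin (n + 1) → Polynomial ℂ) (b : Fin n → Polynomial ℂ),
    (∀ i : Fin n, (b i) ^ 2 = (a i.castSucc) ^ 2 * fP l1 l2 l3 (a i.succ)) ∧
    (∀ i : Fin n, ∀ t : ℂ,
      ¬ ((a i.castSucc).eval t = 0 ∧ (a i.succ).eval t = 0 ∧ (b i).eval t = 0)) ∧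
    (∀ j, (a j).eval 0 = v.val.1 j) ∧ (∀ i, (b i).eval 0 = v.val.2 i) ∧
    (∀ j, (a j).eval 1 = w.val.1 j) ∧ (∀ i, (b i).eval 1 = w.val.2 i)

/-- Over an algebraically closed field, a factor of a square that is coprime to its cofactor is
a square. -/
theorem Polynomial.exists_eq_sq_of_mul_eq_sq {k : Type*} [Field k] [IsAlgClosed k] {p q s : k[X]}
    (hpq : IsCoprime p q) (h : p * q = s ^ 2) : ∃ u : k[X], p = u ^ 2 := by
  obtain ⟨d, c, hc⟩ := exists_associated_pow_of_mul_eq_pow' hpq h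
  obtain ⟨r, -, hr⟩ := Polynomial.isUnit_iff.mp c.isUnit
  obtain ⟨e, he⟩ := IsAlgClosed.exists_pow_nat_eq r (n := 2) (by norm_num)
  refine ⟨d * C e, ?_⟩
  rw [← hc, ← hr, ← he, mul_pow, C_pow]

theorem Polynomial.isCoprime_sub_C_sub_C {k : Type*} [Field k] (p : k[X]) {x y : k} (h : x ≠ y) :
    IsCoprime (p - C x) (p - C y) := by
  refine ⟨C (y - x)⁻¹, -C (y - x)⁻¹, ?_⟩
  have : C (y - x)⁻¹ * C (y - x) = 1 := by
    rw [← C_mul, inv_mul_cancel₀ (sub_ne_zero.mpr h.symm), C_1]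
  rw [C_sub] at this
  linear_combination this

/-- There are no nonconstant polynomial maps from the affine line to `y² = f(x)`. -/
theorem exists_eq_C_of_sq_eq_fP {l1 l2 l3 : ℂ} (h12 : l1 ≠ l2) (h13 : l1 ≠ l3) (h23 : l2 ≠ l3)
    {p s : ℂ[X]} (h : s ^ 2 = fP l1 l2 l3 p) : ∃ c, p = C c := by
  have c12 := p.isCoprime_sub_C_sub_C h12
  have c13 := p.isCoprime_sub_C_sub_C h13
  have c23 := p.isCoprime_sub_C_sub_C h23
  obtain ⟨u, hu⟩ := Polynomial.exists_eq_sq_of_mul_eq_sq (c12.mul_right c13)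
    (by rw [h, fP, mul_assoc])
  obtain ⟨w, hw⟩ := Polynomial.exists_eq_sq_of_mul_eq_sq (c12.symm.mul_right c23)
    (s := s) (by rw [h, fP]; ring)
  have hprod : (u - w) * (u + w) = C (l2 - l1) := by
    rw [C_sub]; linear_combination hw - hu
  have hunit : IsUnit ((u - w) * (u + w)) := by
    rw [hprod, isUnit_C]; exact (sub_ne_zero.mpr h12.symm).isUnit
  obtain ⟨x, -, hx⟩ := Polynomial.isUnit_iff.mp (isUnit_of_mul_isUnit_left hunit)
  obtain ⟨y, -, hy⟩ := Polynomial.isUnit_iff.mp (isUnit_of_mul_isUnit_right hunit)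
  have hC : (C (1 / 2) : ℂ[X]) * 2 = 1 := by
    rw [← C_ofNat, ← C_mul]; norm_num
  have hu' : u = C (1 / 2 * (x + y)) := by
    rw [C_mul, C_add, hx, hy]; linear_combination -u * hC
  refine ⟨(1 / 2 * (x + y)) ^ 2 + l1, ?_⟩
  rw [C_add, C_pow, ← hu']
  linear_combination hu

theorem exists_eq_C_of_sq_eq_sq_mul_fP {l1 l2 l3 : ℂ} (h12 : l1 ≠ l2) (h13 : l1 ≠ l3)
    (h23 : l2 ≠ l3) {a p b : ℂ[X]} (h : b ^ 2 = a ^ 2 * fP l1 l2 l3 p)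
    (hz : ∀ t : ℂ, ¬ (a.eval t = 0 ∧ p.eval t = 0 ∧ b.eval t = 0)) : ∃ c, p = C c := by
  by_cases ha : a = 0
  · have hb : b = 0 := by simpa [ha] using h
    refine ⟨p.coeff 0, eq_C_of_degree_eq_zero ?_⟩
    by_contra hd
    obtain ⟨t, ht⟩ := IsAlgClosed.exists_root p hd
    exact hz t ⟨by simp [ha], ht, by simp [hb]⟩
  · obtain ⟨s, rfl⟩ : a ∣ b :=
      (IsIntegrallyClosed.pow_dvd_pow_iff two_ne_zero).mp ⟨_, h⟩
    rw [mul_pow] at h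
    exact exists_eq_C_of_sq_eq_fP h12 h13 h23 (mul_left_cancel₀ (pow_ne_zero 2 ha) h)

theorem psi_eq_of_chainReln {n : ℕ} {l1 l2 l3 : ℂ} (h12 : l1 ≠ l2) (h13 : l1 ≠ l3)
    (h23 : l2 ≠ l3) {v w : XnSet l1 l2 l3 n} (h : chainReln l1 l2 l3 n v w) :
    (∀ i : Fin n, v.val.1 i.succ = w.val.1 i.succ) ∧
    (∀ i : Fin n, 1 ≤ (i : ℕ) → v.val.2 i = w.val.2 i) := by
  obtain ⟨a, b, hab, hz, ha0, hb0, ha1, hb1⟩ := h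
  have hconst : ∀ i : Fin n, ∃ c, a i.succ = C c := fun i =>
    exists_eq_C_of_sq_eq_sq_mul_fP h12 h13 h23 (hab i) (hz i)
  refine ⟨fun i => ?_, fun i hi => ?_⟩
  · obtain ⟨c, hc⟩ := hconst i
    rw [← ha0, ← ha1, hc, eval_C, eval_C]
  · obtain ⟨c, hc⟩ := hconst i
    obtain ⟨d, hd⟩ := hconst ⟨i - 1, by omega⟩
    have hi' : (⟨i - 1, by omega⟩ : Fin n).succ = i.castSucc := by
      ext; simp; omega
    rw [hi'] at hd
    have hb := hab i
    rw [hc, hd, fP, ← C_sub, ← C_sub, ← C_sub, ← C_mul, ← C_mul, ← C_pow, ← C_mul] at hb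
    have hdeg : (b i).natDegree = 0 := by
      have := congrArg natDegree hb
      rw [natDegree_pow, natDegree_C] at this
      omega
    rw [← hb0, ← hb1, eq_C_of_natDegree_eq_zero hdeg, eval_C, eval_C]

/-- For `n ≥ 1`, pairwise distinct nonzero `λ₁, λ₂, λ₃` and `λ` with
`λ² = −λ₁λ₂λ₃`: if `v, w ∈ Xₙ(ℂ)` are 𝔸¹-chain equivalent, then `pᵢ(v) = pᵢ(w)` for all
`1 ≤ i ≤ n` and `qᵢ(v) = qᵢ(w)` for all `2 ≤ i ≤ n`.  (The projection `ψₙ` factors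
through the naive 𝔸¹-connected components of `Xₙ`.) -/
theorem psi_factors_through_naive_components
    (n : ℕ) (hn : 1 ≤ n)
    (l1 l2 l3 : ℂ) (h1 : l1 ≠ 0) (h2 : l2 ≠ 0) (h3 : l3 ≠ 0)
    (h12 : l1 ≠ l2) (h13 : l1 ≠ l3) (h23 : l2 ≠ l3)
    (lam : ℂ) (hlam : lam ^ 2 = -(l1 * l2 * l3))
    (v w : XnSet l1 l2 l3 n)
    (h : Relation.EqvGen (chainReln l1 l2 l3 n) v w) :
    (∀ i : Fin n, v.val.1 i.succ = w.val.1 i.succ) ∧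
    (∀ i : Fin n, 1 ≤ (i : ℕ) → v.val.2 i = w.val.2 i) := by
  induction h with
  | rel _ _ h => exact psi_eq_of_chainReln h12 h13 h23 h
  | refl _ => exact ⟨fun _ => rfl, fun _ _ => rfl⟩
  | symm _ _ _ ih => exact ⟨fun i => (ih.1 i).symm, fun i hi => (ih.2 i hi).symm⟩
  | trans _ _ _ _ _ ih ih' =>
    exact ⟨fun i => (ih.1 i).trans (ih'.1 i), fun i hi => (ih.2 i hi).trans (ih'.2 i hi)⟩
end
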